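/- Let V be a finite-dimensional vector space over ℚ, H a ℚ-vector space, G a group, ρ : G →* (H ≃ₗ[ℚ] H) a group homomorphism, and b : V →ₗ[ℚ] H a ℚ-linear map. If b is not injective (i.e., its kernel is nontrivial), then the subgroup D(b, ρ) of (V ≃ₗ[ℚ] V) × G consisting of all pairs (ξ, g) with b ∘ ξ = ρ(g) ∘ b is an infinite group. -/

import Mathlib

/-- The subgroup `D(b, ρ)` of `(V ≃ₗ[ℚ] V) × G` consisting of all pairs `(ξ, g)`
satisfying `b ∘ ξ = ρ(g) ∘ b`. -/
def Dsub (V H : Type) [AddCommGroup V] [Module ℚ V] [AddCommGroup H] [Module ℚ H]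
    (G : Type) [Group G] (ρ : G →* (H ≃ₗ[ℚ] H)) (b : V →ₗ[ℚ] H) :
    Subgroup ((V ≃ₗ[ℚ] V) × G) where
  carrier := {p | b.comp (p.1 : V →ₗ[ℚ] V) = ((ρ p.2 : H ≃ₗ[ℚ] H) : H →ₗ[ℚ] H).comp b}
  one_mem' := by
    ext x
    simp
  mul_mem' := by
    intro p q hp hq
    have hp' := fun x => congrArg (fun (φ : V →ₗ[ℚ] H) => φ x) hp
    have hq' := fun x => congrArg (fun (φ : V →ₗ[ℚ] H) => φ x) hq
    simp only [LinearMap.comp_apply, LinearEquiv.coe_coe] at hp' hq'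
    ext x
    simp only [Prod.fst_mul, Prod.snd_mul, map_mul, LinearMap.comp_apply, LinearEquiv.coe_coe]
    show b ((p.1 : V ≃ₗ[ℚ] V) ((q.1 : V ≃ₗ[ℚ] V) x)) = (ρ p.2) ((ρ q.2) (b x))
    rw [hp', hq']
  inv_mem' := by
    intro p hp
    have hp' := fun x => congrArg (fun (φ : V →ₗ[ℚ] H) => φ x) hp
    simp only [LinearMap.comp_apply, LinearEquiv.coe_coe] at hp'
    ext x
    simp only [Prod.fst_inv, Prod.snd_inv, map_inv, LinearMap.comp_apply, LinearEquiv.coe_coe]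
    show b ((p.1 : V ≃ₗ[ℚ] V).symm x) = (ρ p.2).symm (b x)
    refine Eq.symm ?_
    rw [LinearEquiv.symm_apply_eq]
    have := hp' ((p.1 : V ≃ₗ[ℚ] V).symm x)
    rwa [LinearEquiv.apply_symm_apply] at this


/-- The automorphism `x ↦ x + (a - 1) f(x) v`, where `f v = 1`: it scales `v` by `a` and fixes
the kernel of `f` pointwise. -/
def scaleAlong {K V : Type*} [Field K] [AddCommGroup V] [Module K V] (f : V →ₗ[K] K) (v : V)
    (hv : f v = 1) (a : Kˣ) : V ≃ₗ[K] V :=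
  LinearEquiv.ofLinearMap
    (LinearMap.transvection f (((a : K) - 1) • v))
    (LinearMap.transvection f (((a⁻¹ : Kˣ) - 1 : K) • v))
    (by
      rw [LinearMap.transvection.comp_smul_smul, hv,
        show ((a : K) - 1) + ((a⁻¹ : Kˣ) - 1) + ((a⁻¹ : Kˣ) - 1) * 1 * ((a : K) - 1) = 0 by
          linear_combination a.inv_mul]
      simp)
    (by
      rw [LinearMap.transvection.comp_smul_smul, hv,
        show ((a⁻¹ : Kˣ) - 1 : K) + ((a : K) - 1) + ((a : K) - 1) * 1 * ((a⁻¹ : Kˣ) - 1) = 0 by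
          linear_combination a.mul_inv]
      simp)

theorem scaleAlong_apply {K V : Type*} [Field K] [AddCommGroup V] [Module K V] (f : V →ₗ[K] K)
    (v : V) (hv : f v = 1) (a : Kˣ) (x : V) :
    scaleAlong f v hv a x = x + f x • ((a : K) - 1) • v :=
  rfl

theorem scaleAlong_injective {K V : Type*} [Field K] [AddCommGroup V] [Module K V]
    (f : V →ₗ[K] K) (v : V) (hv : f v = 1) : Function.Injective (scaleAlong f v hv) := by
  intro a c h
  have := congrArg (fun ξ : V ≃ₗ[K] V => f (ξ v)) h
  simpa [scaleAlong_apply, hv, Units.ext_iff] using this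

/-- If `b` is a non-injective linear map on a finite-dimensional `ℚ`-vector space, then the
subgroup `D(b, ρ)` is infinite. -/
theorem Dsub_infinite_of_not_injective (V H : Type) [AddCommGroup V] [Module ℚ V]
    [FiniteDimensional ℚ V] [AddCommGroup H] [Module ℚ H]
    (G : Type) [Group G] (ρ : G →* (H ≃ₗ[ℚ] H)) (b : V →ₗ[ℚ] H)
    (hb : LinearMap.ker b ≠ ⊥) :
    Infinite (Dsub V H G ρ b) := by
  obtain ⟨v, hvb, hv⟩ := (Submodule.ne_bot_iff _).mp hb
  obtain ⟨f, hf⟩ := Module.Projective.exists_dual_eq_one ℚ hv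
  have hmem (a : ℚˣ) : (scaleAlong f v hf a, (1 : G)) ∈ Dsub V H G ρ b := by
    change b.comp _ = LinearMap.comp _ b
    ext x
    simp [scaleAlong_apply, LinearMap.mem_ker.mp hvb]
  have : Infinite ℚˣ :=
    Infinite.of_injective (fun n : ℕ => Units.mk0 (n + 1 : ℚ) n.cast_add_one_ne_zero)
      fun m n h => by simpa [Units.ext_iff] using h
  refine Infinite.of_injective (fun a : ℚˣ => (⟨_, hmem a⟩ : Dsub V H G ρ b)) fun a c h => ?_
  exact scaleAlong_injective f v hf (congrArg (fun p => p.1.1) h)
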